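/- Let f : [0,1] → ℝ be càdlàg. For η > 0 set A(η) := sup{ f(y) − f(x) : 0 ≤ x ≤ y ≤ 1, y − x ≤ η }. Then A(η) converges, as η → 0⁺, to the largest positive jump of f on [0,1], i.e. lim_{η→0⁺} A(η) = max(0, sup{ f(s) − f(s⁻) : 0 < s ≤ 1 }). -/

import Mathlib

open Set Filter Topology

/-- Near each point of `[0,1]`, a càdlàg function is close to its value on the right and to its
left limit on the left. -/
theorem exists_ball_close_of_cadlag {f fL : ℝ → ℝ}
    (hrc : ∀ x ∈ Icc (0:ℝ) 1, Tendsto f (𝓝[Icc x 1] x) (𝓝 (f x)))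
    (hll : ∀ s ∈ Ioc (0:ℝ) 1, Tendsto f (𝓝[Ico 0 s] s) (𝓝 (fL s)))
    {c : ℝ} (hc : c ∈ Icc (0:ℝ) 1) {ε : ℝ} (hε : 0 < ε) :
    ∃ δ > 0, ∀ x ∈ Icc (0:ℝ) 1, |x - c| < δ →
      (c ≤ x → |f x - f c| < ε) ∧ (x < c → |f x - fL c| < ε) := by
  obtain ⟨δ, hδ, hr⟩ := Metric.tendsto_nhdsWithin_nhds.1 (hrc c hc) ε hε
  simp only [Real.dist_eq] at hr
  rcases hc.1.eq_or_lt with rfl | hc0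
  · exact ⟨δ, hδ, fun x hx hxc => ⟨fun h => hr ⟨h, hx.2⟩ hxc, fun h => absurd hx.1 h.not_ge⟩⟩
  · obtain ⟨δ', hδ', hl⟩ := Metric.tendsto_nhdsWithin_nhds.1 (hll c ⟨hc0, hc.2⟩) ε hε
    simp only [Real.dist_eq] at hl
    exact ⟨min δ δ', lt_min hδ hδ', fun x hx hxc =>
      ⟨fun h => hr ⟨h, hx.2⟩ (hxc.trans_le (min_le_left _ _)),
        fun h => hl ⟨hx.1, h⟩ (hxc.trans_le (min_le_right _ _))⟩⟩

/-- A càdlàg function on `[0,1]` is bounded. -/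
theorem exists_bound_of_cadlag {f fL : ℝ → ℝ}
    (hrc : ∀ x ∈ Icc (0:ℝ) 1, Tendsto f (𝓝[Icc x 1] x) (𝓝 (f x)))
    (hll : ∀ s ∈ Ioc (0:ℝ) 1, Tendsto f (𝓝[Ico 0 s] s) (𝓝 (fL s))) :
    ∃ C, ∀ x ∈ Icc (0:ℝ) 1, |f x| ≤ C := by
  refine isCompact_Icc.induction_on (p := fun s => ∃ C, ∀ x ∈ s, |f x| ≤ C)
    ⟨0, by simp⟩ (fun s t hst ⟨C, h⟩ => ⟨C, fun x hx => h x (hst hx)⟩) ?_ ?_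
  · rintro s t ⟨C, hC⟩ ⟨D, hD⟩
    exact ⟨max C D, fun x hx => hx.elim (fun h => (hC x h).trans (le_max_left _ _))
      (fun h => (hD x h).trans (le_max_right _ _))⟩
  · intro c hc
    obtain ⟨δ, hδ, h⟩ := exists_ball_close_of_cadlag hrc hll hc one_pos
    refine ⟨Metric.ball c δ ∩ Icc 0 1,
      inter_mem (mem_nhdsWithin_of_mem_nhds (Metric.ball_mem_nhds c hδ)) self_mem_nhdsWithin,
      max (|f c| + 1) (|fL c| + 1), ?_⟩
    rintro x ⟨hxc, hx⟩
    obtain ⟨hr, hl⟩ := h x hx hxc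
    rcases le_or_gt c x with hcx | hcx
    · refine le_trans ?_ (le_max_left _ _)
      linarith [hr hcx, abs_sub_abs_le_abs_sub (f x) (f c)]
    · refine le_trans ?_ (le_max_right _ _)
      linarith [hl hcx, abs_sub_abs_le_abs_sub (f x) (fL c)]

/-- Just before a point of `(0,1]`, a function with left limits is close to its left limit. -/
theorem exists_lt_close_left_limit {f fL : ℝ → ℝ}
    (hrc : ∀ x ∈ Icc (0:ℝ) 1, Tendsto f (𝓝[Icc x 1] x) (𝓝 (f x)))
    (hll : ∀ s ∈ Ioc (0:ℝ) 1, Tendsto f (𝓝[Ico 0 s] s) (𝓝 (fL s)))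
    {s : ℝ} (hs : s ∈ Ioc (0:ℝ) 1) {ε η : ℝ} (hε : 0 < ε) (hη : 0 < η) :
    ∃ x, 0 ≤ x ∧ x < s ∧ s - x ≤ η ∧ |f x - fL s| < ε := by
  obtain ⟨δ, hδ, h⟩ := exists_ball_close_of_cadlag hrc hll (Ioc_subset_Icc_self hs) hε
  obtain ⟨x, hx, hxs⟩ := exists_between (max_lt hs.1 (max_lt (sub_lt_self s hδ) (sub_lt_self s hη)))
  obtain ⟨hx0, hx⟩ := max_lt_iff.1 hx
  obtain ⟨hx1, hx2⟩ := max_lt_iff.1 hx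
  refine ⟨x, hx0.le, hxs, by linarith, (h x ⟨hx0.le, hxs.le.trans hs.2⟩ ?_).2 hxs⟩
  rw [abs_lt]
  constructor <;> linarith

/-- Let `f : [0,1] → ℝ` be càdlàg (right-continuous within the interval
at each point, with left limit `fL s` at each `s ∈ (0,1]`).  For `η > 0` set
`A(η) := sup{ f(y) − f(x) : 0 ≤ x ≤ y ≤ 1, y − x ≤ η }`.  Then `A(η)` converges, as
`η → 0⁺`, to the largest positive jump of `f` on `[0,1]`. -/
theorem small_increment_sup_tendsto_largest_jump
    (f fL : ℝ → ℝ)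
    (hrc : ∀ x ∈ Icc (0:ℝ) 1, Tendsto f (𝓝[Icc x 1] x) (𝓝 (f x)))
    (hll : ∀ s ∈ Ioc (0:ℝ) 1, Tendsto f (𝓝[Ico 0 s] s) (𝓝 (fL s))) :
    Tendsto (fun η : ℝ =>
        sSup {d : ℝ | ∃ x y : ℝ, 0 ≤ x ∧ x ≤ y ∧ y ≤ 1 ∧ y - x ≤ η ∧ d = f y - f x})
      (𝓝[>] 0)
      (𝓝 (max 0 (sSup {d : ℝ | ∃ s ∈ Ioc (0:ℝ) 1, d = f s - fL s}))) := by
  obtain ⟨C, hC⟩ := exists_bound_of_cadlag hrc hll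
  set J := {d : ℝ | ∃ s ∈ Ioc (0:ℝ) 1, d = f s - fL s}
  have hJ : BddAbove J := by
    refine ⟨C + C + 1, ?_⟩
    rintro _ ⟨s, hs, rfl⟩
    obtain ⟨x, hx0, hxs, -, hx⟩ := exists_lt_close_left_limit hrc hll hs one_pos one_pos
    have h1 := abs_le.1 (hC s (Ioc_subset_Icc_self hs))
    have h2 := abs_le.1 (hC x ⟨hx0, hxs.le.trans hs.2⟩)
    have h3 := abs_lt.1 hx
    linarith
  have hbdd (η : ℝ) : BddAbove {d : ℝ | ∃ x y : ℝ,
      0 ≤ x ∧ x ≤ y ∧ y ≤ 1 ∧ y - x ≤ η ∧ d = f y - f x} := by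
    refine ⟨C + C, ?_⟩
    rintro _ ⟨x, y, hx, hxy, hy, -, rfl⟩
    have h1 := abs_le.1 (hC x ⟨hx, hxy.trans hy⟩)
    have h2 := abs_le.1 (hC y ⟨hx.trans hxy, hy⟩)
    linarith
  rw [tendsto_order]
  constructor
  · intro a ha
    filter_upwards [self_mem_nhdsWithin] with η (hη : 0 < η)
    refine ha.trans_le (max_le ?_ (csSup_le ⟨_, 1, by simp, rfl⟩ ?_))
    · exact le_csSup (hbdd η) ⟨0, 0, by simp [hη.le]⟩
    · rintro _ ⟨s, hs, rfl⟩
      refine le_of_forall_pos_le_add fun ε hε => ?_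
      obtain ⟨x, hx0, hxs, hxη, hx⟩ := exists_lt_close_left_limit hrc hll hs hε hη
      have h1 := le_csSup (hbdd η) ⟨x, s, hx0, hxs.le, hs.2, hxη, rfl⟩
      have h2 := abs_lt.1 hx
      linarith
  · intro b hb
    obtain ⟨ε, hε, hεb⟩ : ∃ ε > 0, max 0 (sSup J) + 2 * ε < b :=
      ⟨(b - max 0 (sSup J)) / 4, by linarith, by linarith⟩
    choose! δ hδ hclose using fun c (hc : c ∈ Icc (0:ℝ) 1) =>
      exists_ball_close_of_cadlag hrc hll hc hε
    obtain ⟨ρ, hρ, hcover⟩ := lebesgue_number_lemma_of_metric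
      (isCompact_Icc (a := (0:ℝ)) (b := 1)) (c := fun c : Icc (0:ℝ) 1 => Metric.ball (c : ℝ) (δ c))
      (fun _ => Metric.isOpen_ball)
      (fun x hx => mem_iUnion.2 ⟨⟨x, hx⟩, Metric.mem_ball_self (hδ x hx)⟩)
    filter_upwards [Ioo_mem_nhdsGT hρ] with η hη
    refine lt_of_le_of_lt (csSup_le ⟨_, 0, 0, by simp, by simp, by simp,
      by simp [hη.1.le], rfl⟩ ?_) hεb
    rintro _ ⟨x, y, hx0, hxy, hy1, hyx, rfl⟩
    have hx : x ∈ Icc (0:ℝ) 1 := ⟨hx0, hxy.trans hy1⟩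
    obtain ⟨⟨c, hc⟩, hsub⟩ := hcover x hx
    obtain ⟨hxr, hxl⟩ := hclose c hc x hx (hsub (Metric.mem_ball_self hρ))
    obtain ⟨hyr, hyl⟩ := hclose c hc y ⟨hx0.trans hxy, hy1⟩ <| hsub <| by
      rw [Metric.mem_ball, Real.dist_eq, abs_of_nonneg (sub_nonneg.2 hxy)]
      exact hyx.trans_lt hη.2
    have hM0 := le_max_left 0 (sSup J)
    rcases le_or_gt c x with hcx | hxc
    · have h1 := abs_lt.1 (hxr hcx)
      have h2 := abs_lt.1 (hyr (hcx.trans hxy))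
      linarith
    · have h1 := abs_lt.1 (hxl hxc)
      rcases le_or_gt c y with hcy | hyc
      · have h2 := abs_lt.1 (hyr hcy)
        have h3 : f c - fL c ≤ max 0 (sSup J) :=
          (le_csSup hJ ⟨c, ⟨hx0.trans_lt hxc, hc.2⟩, rfl⟩).trans (le_max_right _ _)
        linarith
      · have h2 := abs_lt.1 (hyl hyc)
        linarith
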